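/- Let r = r(n) be a sequence of integers with 1 ≤ r(n) ≤ n. (i) If r(n)/n → 0 or r(n)/n → α for some α ∈ (0,1), then there exists a constant C > 0 (not depending on m and n) such that for all integers m ≥ 2 and all n, | (d^m/dz^m) S_{n,r}(z) |_{z=0} | ≤ C^m · (m−1)! · r · n^{1−m}. (ii) Without any condition on r(n), for all integers m ≥ 3 and all n, | (d^m/dz^m) S_{n,r}(z) |_{z=0} | ≤ 2 · (m−1)!. -/

import Mathlib

open MeasureTheory Real Filter Finset

/-- `S n r z = Σ_{j=1}^{r} [ log Γ((n−r+j+z)/2) − log Γ((n−r+j)/2) ]`. -/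
noncomputable def S (n r : ℕ) (z : ℝ) : ℝ :=
  ∑ j ∈ Finset.Icc 1 r,
    (Real.log (Real.Gamma (((n : ℝ) - r + j + z) / 2))
      - Real.log (Real.Gamma (((n : ℝ) - r + j) / 2)))

/-- The `m`-th derivative of `z ↦ S n r z` evaluated at `z = 0`. -/
noncomputable def SderivAt0 (n r m : ℕ) : ℝ := iteratedDeriv m (S n r) 0

theorem aux_sum_sq : Summable (fun n : ℕ => (((n : ℝ) + 1) ^ 2)⁻¹) := by
  have h := (summable_nat_add_iff (f := fun n : ℕ => (((n : ℝ)) ^ 2)⁻¹) 1).2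
    (Real.summable_nat_pow_inv.2 (by norm_num))
  simpa using h

/-- Auxiliary digamma function, as a series. -/
noncomputable def psiAux (x : ℝ) : ℝ :=
  -x⁻¹ - (x + 1)⁻¹ + ∑' n : ℕ, (Real.log (n + 2) - Real.log (n + 1) - (x + n + 2)⁻¹)

theorem psi_term_bound (R x : ℝ) (hR : 0 < R) (hx : x ∈ Set.Ioo (-1 : ℝ) R) (n : ℕ) :
    ‖Real.log (n + 2) - Real.log (n + 1) - (x + n + 2)⁻¹‖ ≤ (R + 1) * (((n : ℝ) + 1) ^ 2)⁻¹ := by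
  obtain ⟨h1, h2⟩ := hx
  have hn : (0 : ℝ) ≤ n := Nat.cast_nonneg n
  have hp1 : (0 : ℝ) < n + 1 := by linarith
  have hp2 : (0 : ℝ) < n + 2 := by linarith
  have hpR : (0 : ℝ) < R + n + 2 := by linarith
  have e : Real.log (n + 2) - Real.log (n + 1) = Real.log ((n + 2) / (n + 1)) := by
    rw [Real.log_div hp2.ne' hp1.ne']
  have u1 : Real.log (n + 2) - Real.log (n + 1) ≤ ((n : ℝ) + 1)⁻¹ := by
    rw [e]
    refine (Real.log_le_sub_one_of_pos (by positivity)).trans (le_of_eq ?_)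
    field_simp; ring
  have l1 : (R + n + 2)⁻¹ ≤ Real.log (n + 2) - Real.log (n + 1) := by
    rw [e]
    refine le_trans ?_ (Real.one_sub_inv_le_log_of_pos (by positivity))
    have : 1 - (((n : ℝ) + 2) / (n + 1))⁻¹ = ((n : ℝ) + 2)⁻¹ := by field_simp; ring
    rw [this]
    apply inv_anti₀ hp2
    linarith
  have u2 : (x + n + 2)⁻¹ ≤ ((n : ℝ) + 1)⁻¹ := inv_anti₀ hp1 (by linarith)
  have l2 : (R + n + 2)⁻¹ ≤ (x + n + 2)⁻¹ := inv_anti₀ (by linarith) (by linarith)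
  have key : ((n : ℝ) + 1)⁻¹ - (R + n + 2)⁻¹ ≤ (R + 1) * (((n : ℝ) + 1) ^ 2)⁻¹ := by
    have : ((n : ℝ) + 1)⁻¹ - (R + n + 2)⁻¹ = (R + 1) * (((n : ℝ) + 1) * (R + n + 2))⁻¹ := by
      field_simp; ring
    rw [this]
    apply mul_le_mul_of_nonneg_left _ (by linarith)
    apply inv_anti₀ (by positivity)
    nlinarith
  rw [Real.norm_eq_abs, abs_le]
  constructor <;> linarith

theorem logGamma_hasDerivAt (x : ℝ) (hx : 0 < x) :
    HasDerivAt (fun y => Real.log (Real.Gamma y)) (psiAux x) x := by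
  set R := x + 1 with hR
  have hR0 : 0 < R := by linarith
  set t : Set ℝ := Set.Ioo (-1) R with ht
  have hu : Summable (fun n : ℕ => (R + 1) * (((n : ℝ) + 1) ^ 2)⁻¹) := aux_sum_sq.mul_left _
  set g : ℕ → ℝ → ℝ := fun n y => y * (Real.log (n + 2) - Real.log (n + 1)) + Real.log (n + 2)
    - Real.log (y + n + 2) with hg
  set g' : ℕ → ℝ → ℝ := fun n y => Real.log (n + 2) - Real.log (n + 1) - (y + n + 2)⁻¹ with hg'
  have hd : ∀ n y, y ∈ t → HasDerivAt (g n) (g' n y) y := by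
    intro n y hy
    have hn : (0 : ℝ) ≤ n := Nat.cast_nonneg n
    have hp : y + n + 2 ≠ 0 := by have := hy.1; linarith
    have h1 : HasDerivAt (fun y : ℝ => y + n + 2) 1 y :=
      ((hasDerivAt_id y).add_const _).add_const _
    have h2 := h1.log hp
    have h3 := (((hasDerivAt_id y).mul_const (Real.log (n + 2) - Real.log (n + 1))).add_const
      (Real.log (n + 2))).sub h2
    convert! h3 using 1
    simp [hg']
  have hb : ∀ n y, y ∈ t → ‖g' n y‖ ≤ (R + 1) * (((n : ℝ) + 1) ^ 2)⁻¹ :=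
    fun n y hy => psi_term_bound R y hR0 hy n
  have h0t : (0 : ℝ) ∈ t := ⟨by norm_num, hR0⟩
  have h0 : Summable (fun n => g n 0) := by
    have : (fun n => g n 0) = fun _ => 0 := by
      funext n; simp [hg]
    rw [this]; exact summable_zero
  have hxt : x ∈ t := ⟨by linarith, by linarith⟩
  have hsum := fun y (hy : y ∈ t) => summable_of_summable_hasDerivAt_of_isPreconnected hu isOpen_Ioo
    isPreconnected_Ioo hd hb h0t h0 hy
  have hder := hasDerivAt_tsum_of_isPreconnected hu isOpen_Ioo
    isPreconnected_Ioo hd hb h0t h0 hxt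
  have part : ∀ y : ℝ, 0 < y → ∀ N : ℕ, Real.BohrMollerup.logGammaSeq y (N + 1)
      = -Real.log y - Real.log (y + 1) + ∑ n ∈ Finset.range N, g n y := by
    intro y hy N
    induction N with
    | zero => simp [Real.BohrMollerup.logGammaSeq, Finset.sum_range_succ]; ring
    | succ N ih =>
      rw [Finset.sum_range_succ, ← add_assoc, ← ih]
      unfold Real.BohrMollerup.logGammaSeq
      rw [Finset.sum_range_succ _ (N + 1 + 1), Nat.factorial_succ (N + 1)]
      push_cast
      rw [Real.log_mul (by positivity) (by positivity)]
      simp only [hg]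
      have e1 : (N : ℝ) + 1 + 1 = N + 2 := by ring
      have e2 : y + ((N : ℝ) + 2) = y + N + 2 := by ring
      rw [e1, e2]
      ring
  have heq : ∀ y, 0 < y → y ∈ t → Real.log (Real.Gamma y)
      = -Real.log y - Real.log (y + 1) + ∑' n, g n y := by
    intro y hy hyt
    have l1 := (tendsto_add_atTop_iff_nat 1).2 (Real.BohrMollerup.tendsto_log_gamma hy)
    have l2 := ((hsum y hyt).hasSum.tendsto_sum_nat).const_add (-Real.log y - Real.log (y + 1))
    refine tendsto_nhds_unique l1 (l2.congr fun N => ?_)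
    rw [part y hy N]
  have hfin : HasDerivAt (fun y => -Real.log y - Real.log (y + 1) + ∑' n, g n y) (psiAux x) x := by
    have a1 := (Real.hasDerivAt_log hx.ne').neg
    have a2 := ((hasDerivAt_id x).add_const 1).log (by simp; linarith)
    have := (a1.sub a2).add hder
    convert! this using 1
    simp [psiAux, hg']
  refine hfin.congr_of_eventuallyEq ?_
  filter_upwards [Ioo_mem_nhds hx (show x < R by linarith)] with y hy
  exact heq y hy.1 ⟨by linarith [hy.1], hy.2⟩

theorem aux_summable (a : ℝ) (ha : 0 < a) (m : ℕ) (hm : 2 ≤ m) :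
    Summable (fun k : ℕ => ((a + 2 * k) ^ m)⁻¹) := by
  have h : Summable (fun n : ℕ => (((n : ℝ) + 1) ^ m)⁻¹) := by
    have h := (summable_nat_add_iff (f := fun n : ℕ => (((n : ℝ)) ^ m)⁻¹) 1).2
      (Real.summable_nat_pow_inv.2 (by omega))
    simpa using h
  set c := min a 1
  have hc : 0 < c := lt_min ha one_pos
  refine Summable.of_nonneg_of_le (fun k => by positivity) (fun k => ?_) (h.mul_left ((c ^ m)⁻¹))
  rw [← mul_inv, ← mul_pow]
  apply inv_anti₀ (by positivity)
  apply pow_le_pow_left₀ (by positivity)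
  have h1 : c ≤ a := min_le_left _ _
  have h2 : c ≤ 1 := min_le_right _ _
  have hk : (0 : ℝ) ≤ k := Nat.cast_nonneg k
  nlinarith

/-- `W m a = ∑ 1/(a+2k)^m`. -/
noncomputable def Wsum (m : ℕ) (a : ℝ) : ℝ := ∑' k : ℕ, ((a + 2 * k) ^ m)⁻¹

theorem W_term_deriv (m k : ℕ) (y : ℝ) (hy : 0 < y) :
    HasDerivAt (fun y : ℝ => ((y + 2 * k) ^ m)⁻¹) (-(m : ℝ) * ((y + 2 * k) ^ (m + 1))⁻¹) y := by
  have hp : 0 < y + 2 * (k : ℝ) := by positivity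
  have h1 : HasDerivAt (fun y : ℝ => y + 2 * (k : ℝ)) 1 y := (hasDerivAt_id y).add_const _
  have h2 := (h1.fun_pow m).fun_inv (by positivity)
  convert! h2 using 1
  rcases m with _ | m
  · simp
  · simp only [Nat.add_sub_cancel]
    field_simp
    ring

theorem W_hasDerivAt (m : ℕ) (hm : 2 ≤ m) (a : ℝ) (ha : 0 < a) :
    HasDerivAt (Wsum m) (-(m : ℝ) * Wsum (m + 1) a) a := by
  have hu := (aux_summable (a / 2) (by linarith) (m + 1) (by omega)).mul_left (m : ℝ)
  have hat : a ∈ Set.Ioi (a / 2) := by simp; linarith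
  have := hasDerivAt_tsum_of_isPreconnected hu isOpen_Ioi isPreconnected_Ioi
    (g := fun (k : ℕ) (y : ℝ) => ((y + 2 * (k : ℝ)) ^ m)⁻¹)
    (g' := fun (k : ℕ) (y : ℝ) => -(m : ℝ) * ((y + 2 * (k : ℝ)) ^ (m + 1))⁻¹)
    (fun k y hy => W_term_deriv m k y (by have : a / 2 < y := hy; linarith))
    (fun k y hy => by
      have hy' : a / 2 < y := hy
      have hp : 0 < y + 2 * (k : ℝ) := by have : (0:ℝ) ≤ k := Nat.cast_nonneg k; linarith
      rw [norm_mul, norm_neg, Real.norm_natCast, Real.norm_of_nonneg (by positivity)]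
      gcongr)
    hat (aux_summable a ha m hm) hat
  rw [tsum_mul_left] at this
  exact this

theorem psi_hasDerivAt (x : ℝ) (hx : 0 < x) :
    HasDerivAt psiAux (4 * Wsum 2 (2 * x)) x := by
  set R := x + 1 with hR
  have hR0 : 0 < R := by linarith
  have hd : ∀ (n : ℕ) (y : ℝ), y ∈ Set.Ioi (0 : ℝ) →
      HasDerivAt (fun y : ℝ => Real.log (n + 2) - Real.log (n + 1) - (y + n + 2)⁻¹)
        (((y + n + 2) ^ 2)⁻¹) y := by
    intro n y hy
    have hy' : 0 < y := hy
    have hp : y + n + 2 ≠ 0 := by positivity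
    have h1 : HasDerivAt (fun y : ℝ => y + n + 2) 1 y :=
      ((hasDerivAt_id y).add_const _).add_const _
    have h2 := (h1.fun_inv hp).const_sub (Real.log (n + 2) - Real.log (n + 1))
    convert! h2 using 1
    field_simp
    try simp
  have hs : Summable (fun n : ℕ => Real.log (n + 2) - Real.log (n + 1) - (x + n + 2)⁻¹) :=
    Summable.of_norm_bounded (aux_sum_sq.mul_left (R + 1))
      (fun n => psi_term_bound R x hR0 ⟨by linarith, by linarith⟩ n)
  have hder := hasDerivAt_tsum_of_isPreconnected aux_sum_sq isOpen_Ioi isPreconnected_Ioi hd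
    (fun n y hy => by
      have hy' : (0 : ℝ) < y := hy
      rw [Real.norm_of_nonneg (by positivity)]
      gcongr ?_⁻¹
      gcongr ?_ ^ 2
      linarith) (show x ∈ Set.Ioi (0 : ℝ) from hx) hs (show x ∈ Set.Ioi (0 : ℝ) from hx)
  have a1 := (hasDerivAt_inv hx.ne').neg
  have a2 := ((hasDerivAt_id x).add_const 1).inv (by simp; linarith)
  have := (a1.sub a2).add hder
  convert! this using 1
  have hW := (aux_summable (2 * x) (by linarith) 2 le_rfl)
  unfold Wsum
  rw [← hW.sum_add_tsum_nat_add 2, mul_add, ← tsum_mul_left]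
  congr 1
  · simp [Finset.sum_range_succ]
    field_simp
    ring
  · congr 1
    funext n
    push_cast
    have : 2 * x + 2 * ((n : ℝ) + 2) = 2 * (x + n + 2) := by ring
    rw [this, mul_pow, mul_inv]
    ring

/-- The `m`-th derivative (`m ≥ 1`) of `log Γ(y/2)`. -/
noncomputable def phiD (m : ℕ) (y : ℝ) : ℝ :=
  if m = 1 then psiAux (y / 2) / 2 else (-1) ^ m * ((m - 1).factorial : ℝ) * Wsum m y

theorem phiD_hasDerivAt (m : ℕ) (hm : 1 ≤ m) (y : ℝ) (hy : 0 < y) :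
    HasDerivAt (phiD m) (phiD (m + 1) y) y := by
  rcases eq_or_lt_of_le hm with rfl | hm
  · have h := (psi_hasDerivAt (y / 2) (by linarith)).comp y ((hasDerivAt_id y).div_const 2)
    have h2 := h.div_const 2
    have e : phiD 1 = fun y => psiAux (y / 2) / 2 := by funext y; simp [phiD]
    rw [e]
    convert! h2 using 1
    simp [phiD]
    ring_nf
  · have e : phiD m = fun y => (-1) ^ m * ((m - 1).factorial : ℝ) * Wsum m y := by
      funext y; simp [phiD, show m ≠ 1 by omega]
    rw [e]
    convert! (W_hasDerivAt m hm y hy).const_mul ((-1) ^ m * ((m - 1).factorial : ℝ)) using 1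
    have : (m.factorial : ℝ) = m * (m - 1).factorial := by
      exact_mod_cast (Nat.mul_factorial_pred (by omega)).symm
    simp [phiD, show m ≠ 0 by omega, this]
    ring

theorem S_iter (n r : ℕ) (hrn : r ≤ n) (m : ℕ) (hm : 1 ≤ m) :
    ∀ z : ℝ, -1 < z → iteratedDeriv m (S n r) z =
      ∑ j ∈ Finset.Icc 1 r, phiD m ((n : ℝ) - r + j + z) := by
  have hpos : ∀ j ∈ Finset.Icc 1 r, ∀ z : ℝ, -1 < z → 0 < (n : ℝ) - r + j + z := by
    intro j hj z hz
    have h1 : (1 : ℝ) ≤ j := by exact_mod_cast (Finset.mem_Icc.1 hj).1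
    have h2 : (r : ℝ) ≤ n := by exact_mod_cast hrn
    linarith
  induction m, hm using Nat.le_induction with
  | base =>
    intro z hz
    rw [iteratedDeriv_one]
    apply HasDerivAt.deriv
    unfold S
    apply HasDerivAt.fun_sum
    intro j hj
    have hp := hpos j hj z hz
    have h1 : HasDerivAt (fun z : ℝ => ((n : ℝ) - r + j + z) / 2) (1 / 2) z :=
      ((hasDerivAt_id z).const_add _).div_const 2
    have h2 := ((logGamma_hasDerivAt (((n : ℝ) - r + j + z) / 2) (by linarith)).comp z h1).sub_const
      (Real.log (Real.Gamma (((n : ℝ) - r + j) / 2)))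
    convert! h2 using 1
    simp [phiD]; ring
  | succ m hm ih =>
    intro z hz
    rw [iteratedDeriv_succ]
    apply HasDerivAt.deriv
    have h : HasDerivAt (fun z => ∑ j ∈ Finset.Icc 1 r, phiD m ((n : ℝ) - r + j + z))
        (∑ j ∈ Finset.Icc 1 r, phiD (m + 1) ((n : ℝ) - r + j + z)) z := by
      apply HasDerivAt.fun_sum
      intro j hj
      have h1 : HasDerivAt (fun z : ℝ => (n : ℝ) - r + j + z) 1 z :=
        (hasDerivAt_id z).const_add _
      have := (phiD_hasDerivAt m hm _ (hpos j hj z hz)).comp z h1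
      convert! this using 1
      simp
    refine h.congr_of_eventuallyEq ?_
    filter_upwards [Ioi_mem_nhds hz] with y hy
    exact ih y hy

theorem W_nonneg (m : ℕ) (a : ℝ) (ha : 0 < a) : 0 ≤ Wsum m a :=
  tsum_nonneg fun k => by positivity

theorem S_abs (n r : ℕ) (hrn : r ≤ n) (m : ℕ) (hm : 2 ≤ m) :
    |SderivAt0 n r m| = ((m - 1).factorial : ℝ) *
      ∑ j ∈ Finset.Icc 1 r, Wsum m ((n : ℝ) - r + j) := by
  unfold SderivAt0
  rw [S_iter n r hrn m (by omega) 0 (by norm_num)]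
  simp only [phiD, show m ≠ 1 by omega, if_false, add_zero]
  rw [← Finset.mul_sum, abs_mul, abs_mul, abs_pow]
  simp only [abs_neg, abs_one, one_pow, one_mul, Nat.abs_cast]
  congr 1
  apply abs_of_nonneg
  apply Finset.sum_nonneg
  intro j hj
  have h1 : (1 : ℝ) ≤ j := by exact_mod_cast (Finset.mem_Icc.1 hj).1
  have h2 : (r : ℝ) ≤ n := by exact_mod_cast hrn
  exact W_nonneg _ _ (by linarith)

theorem W_bound_two (m : ℕ) (hm : 2 ≤ m) (a : ℝ) (ha : 1 ≤ a) :
    Wsum m a ≤ 2 * (a ^ (m - 1))⁻¹ := by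
  obtain ⟨p, rfl⟩ : ∃ p, m = p + 2 := ⟨m - 2, by omega⟩
  have h2 : Wsum 2 a ≤ 2 * a⁻¹ := by
    have : ∀ N : ℕ, ∑ k ∈ Finset.range N, ((a + 2 * (k : ℝ)) ^ 2)⁻¹
        ≤ 2 * a⁻¹ - 2 * (a + 2 * (N : ℝ))⁻¹ := by
      intro N
      induction N with
      | zero => simp
      | succ N ih =>
        rw [Finset.sum_range_succ]
        push_cast
        have hb : 1 ≤ a + 2 * (N : ℝ) := by have : (0:ℝ) ≤ N := Nat.cast_nonneg N; linarith
        set b := a + 2 * (N : ℝ)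
        have e : a + 2 * ((N : ℝ) + 1) = b + 2 := by simp [b]; ring
        rw [e]
        have : (b ^ 2)⁻¹ ≤ 2 * b⁻¹ - 2 * (b + 2)⁻¹ := by
          have e : 2 * b⁻¹ - 2 * (b + 2)⁻¹ = 4 / (b * (b + 2)) := by field_simp; ring
          rw [e, inv_eq_one_div, div_le_div_iff₀ (by positivity) (by positivity)]
          nlinarith
        linarith
    refine Real.tsum_le_of_sum_range_le (fun k => by positivity) (fun N => (this N).trans ?_)
    have : 0 ≤ (a + 2 * (N : ℝ))⁻¹ := by positivity
    linarith
  have h3 : Wsum (p + 2) a ≤ (a ^ p)⁻¹ * Wsum 2 a := by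
    unfold Wsum
    rw [← tsum_mul_left]
    refine Summable.tsum_le_tsum (fun k => ?_) (aux_summable a (by linarith) _ (by omega))
      ((aux_summable a (by linarith) 2 le_rfl).mul_left _)
    rw [pow_add, mul_inv]
    have hk : (0:ℝ) ≤ k := Nat.cast_nonneg k
    gcongr
    linarith
  calc Wsum (p + 2) a ≤ (a ^ p)⁻¹ * (2 * a⁻¹) := h3.trans (by gcongr)
    _ = 2 * (a ^ (p + 2 - 1))⁻¹ := by
      rw [show p + 2 - 1 = p + 1 by omega, pow_succ, mul_inv]; ring

theorem W_bound_three (m : ℕ) (hm : 3 ≤ m) (a : ℝ) (ha : 1 ≤ a) :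
    Wsum m a ≤ (a - 1 / 2)⁻¹ - (a + 1 / 2)⁻¹ := by
  have hform : ∀ b : ℝ, 1 ≤ b → (b - 1 / 2)⁻¹ - (b + 1 / 2)⁻¹ = (b ^ 2 - 1 / 4)⁻¹ := by
    intro b hb
    have h1 : b - 1 / 2 ≠ 0 := by linarith
    have h2 : b + 1 / 2 ≠ 0 := by linarith
    have e : b ^ 2 - 1 / 4 = (b - 1 / 2) * (b + 1 / 2) := by ring
    rw [e, inv_sub_inv h1 h2, inv_eq_one_div ((b - 1 / 2) * (b + 1 / 2))]
    congr 1
    ring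
  rw [hform a ha]
  have : ∀ N : ℕ, ∑ k ∈ Finset.range N, ((a + 2 * (k : ℝ)) ^ m)⁻¹
      ≤ (a ^ 2 - 1 / 4)⁻¹ - ((a + 2 * (N : ℝ)) ^ 2 - 1 / 4)⁻¹ := by
    intro N
    induction N with
    | zero => simp
    | succ N ih =>
      rw [Finset.sum_range_succ]
      push_cast
      have hb : 1 ≤ a + 2 * (N : ℝ) := by have : (0:ℝ) ≤ N := Nat.cast_nonneg N; linarith
      set b := a + 2 * (N : ℝ)
      have e : a + 2 * ((N : ℝ) + 1) = b + 2 := by simp [b]; ring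
      rw [e]
      have h1 : (b ^ m)⁻¹ ≤ (b ^ 3)⁻¹ := inv_anti₀ (by positivity) (pow_le_pow_right₀ hb hm)
      have h2 : (b ^ 3)⁻¹ ≤ (b ^ 2 - 1 / 4)⁻¹ - ((b + 2) ^ 2 - 1 / 4)⁻¹ := by
        have p1 : 0 < b ^ 2 - 1 / 4 := by nlinarith
        have p2 : 0 < (b + 2) ^ 2 - 1 / 4 := by nlinarith
        rw [inv_sub_inv p1.ne' p2.ne', inv_eq_one_div, div_le_div_iff₀ (by positivity)
          (by positivity)]
        have q2 : 1 ≤ b ^ 2 := one_le_pow₀ hb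
        have q4 : b ^ 2 ≤ b ^ 4 := pow_le_pow_right₀ hb (by norm_num)
        nlinarith
      linarith
  refine Real.tsum_le_of_sum_range_le (fun k => by positivity) (fun N => (this N).trans ?_)
  have : 0 ≤ ((a + 2 * (N : ℝ)) ^ 2 - 1 / 4)⁻¹ := by
    have : (0:ℝ) ≤ N := Nat.cast_nonneg N
    apply inv_nonneg.2
    nlinarith
  linarith

theorem part_two (n r m : ℕ) (hrn : r ≤ n) (hm : 3 ≤ m) :
    |SderivAt0 n r m| ≤ 2 * ((m - 1).factorial : ℝ) := by
  rw [S_abs n r hrn m (by omega), mul_comm]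
  refine mul_le_mul_of_nonneg_right ?_ (by positivity)
  have h2 : (r : ℝ) ≤ n := by exact_mod_cast hrn
  set d : ℝ := (n : ℝ) - r with hd
  have hd0 : 0 ≤ d := by linarith
  have key : ∀ q : ℕ, ∑ j ∈ Finset.Icc 1 q, Wsum m (d + j)
      ≤ (d + 1 / 2)⁻¹ - (d + q + 1 / 2)⁻¹ := by
    intro q
    induction q with
    | zero => simp
    | succ q ih =>
      rw [Finset.sum_Icc_succ_top (by omega)]
      have hq : (0:ℝ) ≤ q := Nat.cast_nonneg q
      have := W_bound_three m hm (d + ((q + 1 : ℕ) : ℝ)) (by push_cast; linarith)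
      have e : d + ((q + 1 : ℕ) : ℝ) - 1 / 2 = d + q + 1 / 2 := by push_cast; ring
      rw [e] at this
      linarith
  refine (key r).trans ?_
  have p : 0 ≤ (d + r + 1 / 2)⁻¹ := by positivity
  have q : (d + 1 / 2)⁻¹ ≤ (1 / 2 : ℝ)⁻¹ := inv_anti₀ (by norm_num) (by linarith)
  have e : (1 / 2 : ℝ)⁻¹ = 2 := by norm_num
  linarith

theorem part_one_aux (r : ℕ → ℕ) (hr : ∀ n, 1 ≤ n → 1 ≤ r n ∧ r n ≤ n) (α : ℝ) (hα : α < 1)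
    (h : Tendsto (fun n : ℕ => (r n : ℝ) / n) atTop (nhds α)) :
    ∃ c : ℝ, 0 < c ∧ ∀ n : ℕ, 1 ≤ n → c * n ≤ (n : ℝ) - r n + 1 := by
  obtain ⟨β, h1, h2⟩ := exists_between hα
  obtain ⟨N, hN⟩ := eventually_atTop.1 (h.eventually (gt_mem_nhds h1))
  refine ⟨min (1 - β) (1 / (N + 1)), lt_min (by linarith) (by positivity), ?_⟩
  intro n hn
  have hn0 : (0 : ℝ) < n := by exact_mod_cast hn
  have hrn : (r n : ℝ) ≤ n := by exact_mod_cast (hr n hn).2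
  rcases le_total N n with hle | hle
  · have := hN n hle
    rw [div_lt_iff₀ hn0] at this
    have := mul_le_mul_of_nonneg_right (min_le_left (1 - β) (1 / ((N : ℝ) + 1))) hn0.le
    linarith
  · have := mul_le_mul_of_nonneg_right (min_le_right (1 - β) (1 / ((N : ℝ) + 1))) hn0.le
    have h3 : 1 / ((N : ℝ) + 1) * n ≤ 1 := by
      rw [one_div, inv_mul_le_iff₀ (by positivity)]
      have : (n : ℝ) ≤ N := by exact_mod_cast hle
      linarith
    linarith

theorem part_one (r : ℕ → ℕ) (hr : ∀ n, 1 ≤ n → 1 ≤ r n ∧ r n ≤ n) (α : ℝ) (hα : α < 1)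
    (h : Tendsto (fun n : ℕ => (r n : ℝ) / n) atTop (nhds α)) :
    ∃ C : ℝ, 0 < C ∧ ∀ m : ℕ, 2 ≤ m → ∀ n : ℕ, 1 ≤ n →
        |SderivAt0 n (r n) m|
          ≤ C ^ m * ((m - 1).factorial : ℝ) * (r n : ℝ) * (n : ℝ) ^ (1 - (m : ℤ)) := by
  obtain ⟨c₀, hc₀, hcn₀⟩ := part_one_aux r hr α hα h
  obtain ⟨c, hc, hc1, hcn⟩ : ∃ c : ℝ, 0 < c ∧ c ≤ 1 ∧
      ∀ n : ℕ, 1 ≤ n → c * n ≤ (n : ℝ) - r n + 1 := by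
    refine ⟨min c₀ 1, lt_min hc₀ one_pos, min_le_right _ _, fun n hn => ?_⟩
    refine le_trans ?_ (hcn₀ n hn)
    gcongr
    exact min_le_left _ _
  refine ⟨2 / c, by positivity, fun m hm n hn => ?_⟩
  obtain ⟨p, rfl⟩ : ∃ p, m = p + 2 := ⟨m - 2, by omega⟩
  have hn0 : (0 : ℝ) < n := by exact_mod_cast hn
  have hrn : (r n : ℝ) ≤ n := by exact_mod_cast (hr n hn).2
  rw [S_abs n (r n) (hr n hn).2 _ hm]
  have hz : (n : ℝ) ^ (1 - ((p + 2 : ℕ) : ℤ)) = ((n : ℝ) ^ (p + 1))⁻¹ := by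
    rw [show (1 - ((p + 2 : ℕ) : ℤ)) = -((p + 1 : ℕ) : ℤ) by push_cast; ring, zpow_neg,
      zpow_natCast]
  rw [hz]
  have hsum : ∑ j ∈ Finset.Icc 1 (r n), Wsum (p + 2) ((n : ℝ) - r n + j)
      ≤ ∑ j ∈ Finset.Icc 1 (r n), (2 / c) ^ (p + 2) * ((n : ℝ) ^ (p + 1))⁻¹ := by
    apply Finset.sum_le_sum
    intro j hj
    have h1 : (1 : ℝ) ≤ j := by exact_mod_cast (Finset.mem_Icc.1 hj).1
    refine (W_bound_two (p + 2) hm _ (by linarith)).trans ?_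
    rw [show p + 2 - 1 = p + 1 by omega]
    have hb : c * n ≤ (n : ℝ) - r n + j := by linarith [hcn n hn]
    calc 2 * (((n : ℝ) - r n + j) ^ (p + 1))⁻¹ ≤ 2 * ((c * n) ^ (p + 1))⁻¹ := by gcongr
      _ = 2 * (c⁻¹) ^ (p + 1) * ((n : ℝ) ^ (p + 1))⁻¹ := by rw [mul_pow, mul_inv, inv_pow]; ring
      _ ≤ (2 / c) ^ (p + 2) * ((n : ℝ) ^ (p + 1))⁻¹ := by
        gcongr
        rw [div_eq_mul_inv, mul_pow]
        have hci : 1 ≤ c⁻¹ := (one_le_inv₀ hc).2 hc1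
        have a1 : (2 : ℝ) ≤ 2 ^ (p + 2) := le_self_pow₀ (by norm_num) (by omega)
        have a2 : c⁻¹ ^ (p + 1) ≤ c⁻¹ ^ (p + 2) := pow_le_pow_right₀ hci (by omega)
        gcongr
  rw [Finset.sum_const, Nat.card_Icc, nsmul_eq_mul, Nat.add_sub_cancel] at hsum
  calc _ ≤ (((p + 2 - 1).factorial : ℕ) : ℝ) *
        ((r n : ℝ) * ((2 / c) ^ (p + 2) * ((n : ℝ) ^ (p + 1))⁻¹)) := by gcongr
    _ = _ := by ring

theorem stmt12 (r : ℕ → ℕ) (hr : ∀ n, 1 ≤ n → 1 ≤ r n ∧ r n ≤ n) :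
    ((Tendsto (fun n : ℕ => (r n : ℝ) / n) atTop (nhds 0)
        ∨ ∃ α ∈ Set.Ioo (0 : ℝ) 1,
            Tendsto (fun n : ℕ => (r n : ℝ) / n) atTop (nhds α)) →
      ∃ C : ℝ, 0 < C ∧ ∀ m : ℕ, 2 ≤ m → ∀ n : ℕ, 1 ≤ n →
        |SderivAt0 n (r n) m|
          ≤ C ^ m * ((m - 1).factorial : ℝ) * (r n : ℝ) * (n : ℝ) ^ (1 - (m : ℤ)))
    ∧ ∀ m : ℕ, 3 ≤ m → ∀ n : ℕ, 1 ≤ n →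
        |SderivAt0 n (r n) m| ≤ 2 * ((m - 1).factorial : ℝ) := by
  refine ⟨?_, fun m hm n hn => part_two n (r n) m (hr n hn).2 hm⟩
  rintro (h | ⟨α, hα, h⟩)
  · exact part_one r hr 0 one_pos h
  · exact part_one r hr α hα.2 h
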